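/- arXiv:2201.09399 — 3 statements merged into one kernel-verified Lean document; each statement's English description precedes it below -/
import Mathlib

section
/- Let G be a simple graph and S ⊆ V(G). Then S satisfies the three conditions: (i) for every v ∈ V(G), |N[v] ∩ S| ≥ 2; (ii) for every v ∈ S and every u ∈ V(G)−S, |((N(v) ∩ S) △ (N(u) ∩ S)) − {v}| ≥ 1; (iii) for all distinct u, v ∈ V(G)−S, |(N(v) ∩ S) △ (N(u) ∩ S)| ≥ 2; if and only if S satisfies the two conditions: (a) for every v ∈ V(G), |N[v] ∩ S| ≥ 2; (b) for all distinct u, v ∈ V(G), |((N(v) ∩ S) △ (N(u) ∩ S)) − {v, u}| ≥ 2 − |{v, u} ∩ S|. -/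
open scoped symmDiff

theorem symmDiff_inter_subset_right {α : Type*} (A B S : Set α) :
    (A ∩ S) ∆ (B ∩ S) ⊆ S :=
  Set.symmDiff_subset_union.trans
    (Set.union_subset Set.inter_subset_right Set.inter_subset_right)

theorem sdiff_pair_eq_sdiff_singleton {α : Type*} {D S : Set α} {u : α} (v : α)
    (hD : D ⊆ S) (hu : u ∉ S) : D \ {v, u} = D \ {v} := by
  ext x
  have := @hD x
  simp only [Set.mem_sdiff, Set.mem_insert_iff, Set.mem_singleton_iff]
  grind

theorem sdiff_pair_eq_self {α : Type*} {D S : Set α} {u v : α}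
    (hD : D ⊆ S) (hv : v ∉ S) (hu : u ∉ S) : D \ {v, u} = D := by
  rw [sdiff_pair_eq_sdiff_singleton v hD hu]
  exact Set.sdiff_singleton_eq_self fun h => hv (hD h)

theorem two_sub_encard_pair_inter_of_mem_of_notMem {α : Type*} {S : Set α} {u v : α}
    (hv : v ∈ S) (hu : u ∉ S) : 2 - (({v, u} : Set α) ∩ S).encard = 1 := by
  rw [Set.insert_inter_of_mem hv, Set.singleton_inter_eq_empty.mpr hu, insert_empty_eq,
    Set.encard_singleton]
  rfl

theorem two_sub_encard_pair_inter_of_notMem {α : Type*} {S : Set α} {u v : α}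
    (hv : v ∉ S) (hu : u ∉ S) : 2 - (({v, u} : Set α) ∩ S).encard = 2 := by
  rw [Set.insert_inter_of_notMem hv, Set.singleton_inter_eq_empty.mpr hu, Set.encard_empty,
    tsub_zero]

theorem two_sub_encard_pair_inter_of_mem {α : Type*} {S : Set α} {u v : α}
    (hv : v ∈ S) (hu : u ∈ S) (huv : u ≠ v) :
    2 - (({v, u} : Set α) ∩ S).encard = 0 := by
  rw [Set.inter_eq_left.mpr (Set.pair_subset hv hu), Set.encard_pair huv.symm, tsub_self]

/-- Equivalence of the two characterizations of redundant locating-dominating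
(RED:LD) sets. -/
theorem redld_conditions_equiv {V : Type*} (G : SimpleGraph V) (S : Set V) :
    ((∀ v : V, 2 ≤ ((insert v (G.neighborSet v)) ∩ S).encard) ∧
     (∀ v ∈ S, ∀ u ∉ S,
        1 ≤ (((G.neighborSet v ∩ S) ∆ (G.neighborSet u ∩ S)) \ {v}).encard) ∧
     (∀ u ∉ S, ∀ v ∉ S, u ≠ v →
        2 ≤ ((G.neighborSet v ∩ S) ∆ (G.neighborSet u ∩ S)).encard)) ↔
    ((∀ v : V, 2 ≤ ((insert v (G.neighborSet v)) ∩ S).encard) ∧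
     (∀ u v : V, u ≠ v →
        2 - (({v, u} : Set V) ∩ S).encard ≤
          (((G.neighborSet v ∩ S) ∆ (G.neighborSet u ∩ S)) \ {v, u}).encard)) := by
  have hD (u v : V) := symmDiff_inter_subset_right (G.neighborSet v) (G.neighborSet u) S
  refine and_congr_right fun _ => ⟨?_, fun h => ⟨fun v hv u hu => ?_, fun u hu v hv huv => ?_⟩⟩
  · rintro ⟨h₁, h₂⟩ u v huv
    by_cases hv : v ∈ S <;> by_cases hu : u ∈ S
    · rw [two_sub_encard_pair_inter_of_mem hv hu huv]
      exact zero_le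
    · rw [two_sub_encard_pair_inter_of_mem_of_notMem hv hu,
        sdiff_pair_eq_sdiff_singleton v (hD u v) hu]
      exact h₁ v hv u hu
    · rw [Set.pair_comm, two_sub_encard_pair_inter_of_mem_of_notMem hu hv,
        sdiff_pair_eq_sdiff_singleton u (hD u v) hv, symmDiff_comm]
      exact h₁ u hu v hv
    · rw [two_sub_encard_pair_inter_of_notMem hv hu, sdiff_pair_eq_self (hD u v) hv hu]
      exact h₂ u hu v hv huv
  · have huv : u ≠ v := fun e => hu (e ▸ hv)
    have key := h u v huv
    rwa [two_sub_encard_pair_inter_of_mem_of_notMem hv hu,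
      sdiff_pair_eq_sdiff_singleton v (hD u v) hu] at key
  · have key := h u v huv
    rwa [two_sub_encard_pair_inter_of_notMem hv hu,
      sdiff_pair_eq_self (hD u v) hv hu] at key
end

section
/- Let G be a simple graph and S ⊆ V(G). Then S satisfies the four conditions: (i) for every v ∈ V(G), |N[v] ∩ S| ≥ 3; (ii) for all distinct u, v ∈ S, |((N(v) ∩ S) △ (N(u) ∩ S)) − {v, u}| ≥ 1; (iii) for every v ∈ V(G)−S and every u ∈ S, |((N(v) ∩ S) △ (N(u) ∩ S)) − {u}| ≥ 2; (iv) for all distinct u, v ∈ V(G)−S, |(N(v) ∩ S) △ (N(u) ∩ S)| ≥ 3; if and only if S satisfies the two conditions: (a) for every v ∈ V(G), |N[v] ∩ S| ≥ 3; (b) for all distinct u, v ∈ V(G), |((N(v) ∩ S) △ (N(u) ∩ S)) − {v, u}| ≥ 3 − |{v, u} ∩ S|. -/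
open scoped symmDiff

/-- Points outside `S` may be removed from a symmetric difference of traces on `S` for free. -/
theorem symmDiff_inter_sdiff_insert {α : Type*} (A B S T : Set α) {x : α} (hx : x ∉ S) :
    ((A ∩ S) ∆ (B ∩ S)) \ insert x T = ((A ∩ S) ∆ (B ∩ S)) \ T := by
  ext y
  simp only [Set.mem_sdiff, Set.mem_insert_iff, Set.mem_symmDiff, Set.mem_inter_iff]
  grind

/-- Equivalence of the two characterizations of error-correcting
locating-dominating (ERR:LD) sets. -/
theorem errld_conditions_equiv {V : Type*} (G : SimpleGraph V) (S : Set V) :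
    ((∀ v : V, 3 ≤ ((insert v (G.neighborSet v)) ∩ S).encard) ∧
     (∀ u ∈ S, ∀ v ∈ S, u ≠ v →
        1 ≤ (((G.neighborSet v ∩ S) ∆ (G.neighborSet u ∩ S)) \ {v, u}).encard) ∧
     (∀ v ∉ S, ∀ u ∈ S,
        2 ≤ (((G.neighborSet v ∩ S) ∆ (G.neighborSet u ∩ S)) \ {u}).encard) ∧
     (∀ u ∉ S, ∀ v ∉ S, u ≠ v →
        3 ≤ ((G.neighborSet v ∩ S) ∆ (G.neighborSet u ∩ S)).encard)) ↔
    ((∀ v : V, 3 ≤ ((insert v (G.neighborSet v)) ∩ S).encard) ∧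
     (∀ u v : V, u ≠ v →
        3 - (({v, u} : Set V) ∩ S).encard ≤
          (((G.neighborSet v ∩ S) ∆ (G.neighborSet u ∩ S)) \ {v, u}).encard)) := by
  have three_sub_one : (3 : ℕ∞) - 1 = 2 := rfl
  have three_sub_two : (3 : ℕ∞) - 2 = 1 := rfl
  have pair_inter_of_mem {u v : V} (hu : u ∈ S) (hv : v ∈ S) (h : u ≠ v) :
      (({v, u} : Set V) ∩ S).encard = 2 := by
    rw [Set.insert_inter_of_mem hv, Set.singleton_inter_of_mem hu, Set.encard_pair h.symm]
  have pair_inter_of_notMem {u v : V} (hu : u ∈ S) (hv : v ∉ S) :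
      (({v, u} : Set V) ∩ S).encard = 1 := by
    rw [Set.insert_inter_of_notMem hv, Set.singleton_inter_of_mem hu, Set.encard_singleton]
  have pair_inter_of_notMem_of_notMem {u v : V} (hu : u ∉ S) (hv : v ∉ S) :
      (({v, u} : Set V) ∩ S).encard = 0 := by
    rw [Set.insert_inter_of_notMem hv, Set.singleton_inter_of_notMem hu, Set.encard_empty]
  have sdiff_pair {u v : V} (hu : u ∉ S) (hv : v ∉ S) :
      ((G.neighborSet v ∩ S) ∆ (G.neighborSet u ∩ S)) \ {v, u} =
        (G.neighborSet v ∩ S) ∆ (G.neighborSet u ∩ S) := by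
    rw [symmDiff_inter_sdiff_insert _ _ _ _ hv, ← insert_empty_eq u,
      symmDiff_inter_sdiff_insert _ _ _ _ hu, Set.sdiff_empty]
  refine and_congr_right fun _ => ⟨?_, fun h => ⟨?_, ?_, ?_⟩⟩
  · rintro ⟨h₁, h₂, h₃⟩ u v huv
    by_cases hu : u ∈ S <;> by_cases hv : v ∈ S
    · rw [pair_inter_of_mem hu hv huv, three_sub_two]
      exact h₁ u hu v hv huv
    · rw [pair_inter_of_notMem hu hv, three_sub_one, symmDiff_inter_sdiff_insert _ _ _ _ hv]
      exact h₂ v hv u hu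
    · rw [Set.pair_comm, pair_inter_of_notMem hv hu, three_sub_one, symmDiff_comm,
        symmDiff_inter_sdiff_insert _ _ _ _ hu]
      exact h₂ u hu v hv
    · rw [pair_inter_of_notMem_of_notMem hu hv, tsub_zero, sdiff_pair hu hv]
      exact h₃ u hu v hv huv
  · intro u hu v hv huv
    simpa only [pair_inter_of_mem hu hv huv, three_sub_two] using h u v huv
  · intro v hv u hu
    simpa only [pair_inter_of_notMem hu hv, three_sub_one,
      symmDiff_inter_sdiff_insert _ _ _ _ hv] using h u v (ne_of_mem_of_not_mem hu hv)
  · intro u hu v hv huv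
    simpa only [pair_inter_of_notMem_of_notMem hu hv, tsub_zero, sdiff_pair hu hv] using h u v huv
end

section
/- Let G be a simple graph and S ⊆ V(G) be an error-detecting locating-dominating (DET:LD) set. Then S is a redundant locating-dominating (RED:LD) set; that is, S satisfies: (i) for every v ∈ V(G), |N[v] ∩ S| ≥ 2; (ii) for every v ∈ S and every u ∈ V(G)−S, |((N(v) ∩ S) △ (N(u) ∩ S)) − {v}| ≥ 1; (iii) for all distinct u, v ∈ V(G)−S, |(N(v) ∩ S) △ (N(u) ∩ S)| ≥ 2. -/
open scoped symmDiff

/-- Every error-detecting locating-dominating (DET:LD) set is a redundant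
locating-dominating (RED:LD) set. -/
theorem detld_is_redld {V : Type*} (G : SimpleGraph V) (S : Set V)
    (h1 : ∀ v : V, 2 ≤ ((insert v (G.neighborSet v)) ∩ S).encard)
    (h2 : ∀ u ∈ S, ∀ v ∈ S, u ≠ v →
        (G.neighborSet v ∩ S) ∆ (G.neighborSet u ∩ S) ≠ ∅)
    (h3 : ∀ v ∉ S, ∀ u ∈ S,
        2 ≤ ((G.neighborSet v ∩ S) \ (G.neighborSet u ∩ S)).encard ∨
        1 ≤ ((G.neighborSet u ∩ S) \ (G.neighborSet v ∩ S)).encard)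
    (h4 : ∀ u ∉ S, ∀ v ∉ S, u ≠ v →
        2 ≤ ((G.neighborSet v ∩ S) \ (G.neighborSet u ∩ S)).encard ∨
        2 ≤ ((G.neighborSet u ∩ S) \ (G.neighborSet v ∩ S)).encard) :
    (∀ v : V, 2 ≤ ((insert v (G.neighborSet v)) ∩ S).encard) ∧
    (∀ v ∈ S, ∀ u ∉ S,
        1 ≤ (((G.neighborSet v ∩ S) ∆ (G.neighborSet u ∩ S)) \ {v}).encard) ∧
    (∀ u ∉ S, ∀ v ∉ S, u ≠ v →
        2 ≤ ((G.neighborSet v ∩ S) ∆ (G.neighborSet u ∩ S)).encard) := by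
  refine ⟨h1, fun v hv u hu => ?_, fun u hu v hv huv => ?_⟩
  · rw [Set.one_le_encard_iff_nonempty]
    rcases h3 u hu v hv with h | h
    · have hnt := Set.one_lt_encard_iff_nontrivial.mp ((by norm_num : (1 : ℕ∞) < 2).trans_le h)
      obtain ⟨x, hx, hxv⟩ := hnt.exists_ne v
      exact ⟨x, Or.inr hx, hxv⟩
    · obtain ⟨x, hx⟩ := Set.one_le_encard_iff_nonempty.mp h
      exact ⟨x, Or.inl hx, (G.ne_of_adj hx.1.1).symm⟩
  · rcases h4 u hu v hv huv with h | h
    · exact h.trans (Set.encard_le_encard fun x hx => Or.inl hx)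
    · exact h.trans (Set.encard_le_encard fun x hx => Or.inr hx)
end
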